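/- Let H : ℝⁿ → ℝ satisfy H(0) = 0, be nondecreasing with respect to the componentwise order (0 ≤ y ≤ y′ componentwise implies H(y) ≤ H(y′)), and have nondecreasing increments: for all y, y′, Δ ∈ ℝⁿ with 0 ≤ y ≤ y′ and Δ ≥ 0 componentwise, H(y + Δ) − H(y) ≤ H(y′ + Δ) − H(y′). Let M ≥ 1 and let s₀, s₁, …, s_M ∈ ℝⁿ with s₀ = 0 and 0 ≤ s_{j−1} ≤ s_j componentwise for each j, let ŝ₁, …, ŝ_M ∈ ℝⁿ with s_{j−1} ≤ ŝ_j componentwise for each j, and let a₁, …, a_M ∈ ℝⁿ with a_j ≥ 0 and s_j − s_{j−1} ≤ a_j componentwise for each j. Then H(s_M) ≤ Σ_{j=1}^{M} [H(ŝ_j + a_j) − H(ŝ_j)]. -/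

import Mathlib

/-- If `H : ℝⁿ → ℝ` vanishes at `0`, is nondecreasing w.r.t. the componentwise
order on the nonnegative orthant, and has nondecreasing increments, then for cumulative
consumption vectors `s_j` (with `s 0 = 0`, `0 ≤ s (j-1) ≤ s j`), placement-time vectors
`sHat_j ≥ s (j-1)`, and per-instance vectors `a_j ≥ 0` with `s j − s (j-1) ≤ a j`,
`H(s M) ≤ Σ_{j=1}^{M} [H(sHat j + a j) − H(sHat j)]`. -/
theorem stmt_8 (n M : ℕ) (hM : 1 ≤ M) (H : (Fin n → ℝ) → ℝ)
    (hH0 : H 0 = 0)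
    (hmono : ∀ y y' : Fin n → ℝ, (∀ i, 0 ≤ y i) → (∀ i, y i ≤ y' i) → H y ≤ H y')
    (hincr : ∀ y y' Δ : Fin n → ℝ, (∀ i, 0 ≤ y i) → (∀ i, y i ≤ y' i) →
      (∀ i, 0 ≤ Δ i) → H (y + Δ) - H y ≤ H (y' + Δ) - H y')
    (s sHat a : ℕ → Fin n → ℝ)
    (hs0 : s 0 = 0)
    (hs : ∀ j, 1 ≤ j → j ≤ M → (∀ i, 0 ≤ s (j - 1) i) ∧ (∀ i, s (j - 1) i ≤ s j i))
    (hsHat : ∀ j, 1 ≤ j → j ≤ M → ∀ i, s (j - 1) i ≤ sHat j i)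
    (ha : ∀ j, 1 ≤ j → j ≤ M →
      (∀ i, 0 ≤ a j i) ∧ (∀ i, s j i - s (j - 1) i ≤ a j i)) :
    H (s M) ≤ ∑ j ∈ Finset.Icc 1 M, (H (sHat j + a j) - H (sHat j)) := by
  have key : ∀ m, m ≤ M →
      H (s m) ≤ ∑ j ∈ Finset.Icc 1 m, (H (sHat j + a j) - H (sHat j)) := by
    intro m
    induction m with
    | zero => intro _; simp [hs0, hH0]
    | succ k ih =>
      intro hk
      rw [Finset.sum_Icc_succ_top (by omega)]
      have h1 := ih (by omega)
      obtain ⟨p0, p1⟩ := hs (k + 1) (by omega) hk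
      have p2 := hsHat (k + 1) (by omega) hk
      obtain ⟨p3, p4⟩ := ha (k + 1) (by omega) hk
      simp only [Nat.add_sub_cancel] at p0 p1 p2 p4
      have h2 := hincr (s k) (sHat (k + 1)) (a (k + 1)) p0 p2 p3
      have h3 := hmono (s (k + 1)) (s k + a (k + 1))
        (fun i => (p0 i).trans (p1 i))
        (fun i => by have := p4 i; simp only [Pi.add_apply]; linarith)
      linarith
  exact key M le_rfl
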